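/- arXiv:2211.01937 — 7 statements merged into one kernel-verified Lean document; each statement's English description precedes it below -/
import Mathlib

section
/- Let T be a terminal set for D. Then the colimit of G in the category of R-modules is isomorphic, as an R-module, to the quotient of the direct sum ⨁_{t ∈ T} G(t) by the submodule generated by all elements ι_t(G(a)(v)) − ι_{t'}(G(a')(v)), where c ranges over the objects of D, a : c ⟶ t and a' : c ⟶ t' range over pairs of morphisms of D with t, t' ∈ T, and v ranges over G(c). -/
/-!
STATEMENT 0.  `R` is a commutative ring, `D` a small category, `G : D ⥤ ModuleCat R`.
If `T` is a terminal set for `D`, then `colim G` is isomorphic, as an `R`-module, to the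
quotient of `⨁ t : T, G t` by the submodule generated by all elements
`ι_t (G a v) - ι_{t'} (G a' v)` for spans `a : c ⟶ t`, `a' : c ⟶ t'` with `t, t' ∈ T`
and `v ∈ G c`.
-/

open CategoryTheory CategoryTheory.Limits DirectSum

attribute [local instance] Classical.propDecidable

universe u

/-- A set `T` of objects of a small category `D` is *terminal* if for every object `c` of `D`
there exist `t ∈ T` and a morphism `c ⟶ t` in `D`. -/
def IsTerminalSet {D : Type u} [SmallCategory D] (T : Set D) : Prop :=
  ∀ c : D, ∃ t ∈ T, Nonempty (c ⟶ t)

theorem statement0 {R : Type u} [CommRing R] {D : Type u} [SmallCategory D]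
    (G : D ⥤ ModuleCat.{u} R) (T : Set D) (hT : IsTerminalSet T) :
    Nonempty (
      ((⨁ t : T, ↥(G.obj t.1)) ⧸
        Submodule.span R
          {x : ⨁ t : T, ↥(G.obj t.1) |
            ∃ (c : D) (t t' : T) (a : c ⟶ t.1) (a' : c ⟶ t'.1) (v : G.obj c),
              x = DirectSum.lof R T (fun s : T => ↥(G.obj s.1)) t (G.map a v)
                  - DirectSum.lof R T (fun s : T => ↥(G.obj s.1)) t' (G.map a' v)})
      ≃ₗ[R] ↥(colimit G)) := by
  classical
  choose τ hτ hα using hT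
  let α : ∀ c, c ⟶ τ c := fun c => (hα c).some
  generalize hS : Submodule.span R
          {x : ⨁ t : T, ↥(G.obj t.1) |
            ∃ (c : D) (t t' : T) (a : c ⟶ t.1) (a' : c ⟶ t'.1) (v : G.obj c),
              x = DirectSum.lof R T (fun s : T => ↥(G.obj s.1)) t (G.map a v)
                  - DirectSum.lof R T (fun s : T => ↥(G.obj s.1)) t' (G.map a' v)} = S
  have key : ∀ (c : D) (t t' : T) (a : c ⟶ t.1) (a' : c ⟶ t'.1) (v : G.obj c),
      S.mkQ (DirectSum.lof R T (fun s : T => ↥(G.obj s.1)) t (G.map a v)) =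
      S.mkQ (DirectSum.lof R T (fun s : T => ↥(G.obj s.1)) t' (G.map a' v)) := by
    intro c t t' a a' v
    rw [← sub_eq_zero, ← map_sub, Submodule.mkQ_apply, Submodule.Quotient.mk_eq_zero, ← hS]
    exact Submodule.subset_span ⟨c, t, t', a, a', v, rfl⟩
  have hw : ∀ {c d : D} (f : c ⟶ d) (v : G.obj c),
      colimit.ι G d (G.map f v) = colimit.ι G c v := by
    intro c d f v
    have h := congrArg (fun k => k.hom v) (colimit.w G f)
    simpa using h
  let p : (⨁ t : T, ↥(G.obj t.1)) →ₗ[R] ↥(colimit G) :=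
    DirectSum.toModule R T _ (fun t => (colimit.ι G t.1).hom)
  have hp : ∀ (t : T) (v : G.obj t.1),
      p (DirectSum.lof R T (fun s : T => ↥(G.obj s.1)) t v) = colimit.ι G t.1 v := by
    intro t v
    exact DirectSum.toModule_lof (M := fun s : T => ↥(G.obj s.1)) R t v
  have hle : S ≤ LinearMap.ker p := by
    rw [← hS, Submodule.span_le]
    rintro _ ⟨c, t, t', a, a', v, rfl⟩
    simp only [SetLike.mem_coe, LinearMap.mem_ker]
    rw [map_sub, hp, hp, hw, hw, sub_self]
  let j : ∀ c : D, G.obj c →ₗ[R] ((⨁ t : T, ↥(G.obj t.1)) ⧸ S) := fun c =>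
    S.mkQ ∘ₗ DirectSum.lof R T (fun s : T => ↥(G.obj s.1)) ⟨τ c, hτ c⟩ ∘ₗ (G.map (α c)).hom
  have hj : ∀ (c : D) (t : T) (a : c ⟶ t.1) (v : G.obj c),
      j c v = S.mkQ (DirectSum.lof R T (fun s : T => ↥(G.obj s.1)) t (G.map a v)) :=
    fun c t a v => key c ⟨τ c, hτ c⟩ t (α c) a v
  let K : Cocone G :=
    { pt := ModuleCat.of R ((⨁ t : T, ↥(G.obj t.1)) ⧸ S)
      ι := { app := fun c => ModuleCat.ofHom (j c)
             naturality := by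
              intro c d f
              ext v
              change j d (G.map f v) = j c v
              rw [hj c ⟨τ d, hτ d⟩ (f ≫ α d) v, G.map_comp]
              rfl } }
  have hK : ∀ (c : D) (v : G.obj c), (colimit.desc G K).hom (colimit.ι G c v) = j c v := by
    intro c v
    have h := congrArg (fun k => k.hom v) (colimit.ι_desc K c)
    exact h
  let q := S.liftQ p hle
  have hq : ∀ x, q (S.mkQ x) = p x := fun x => Submodule.liftQ_apply S p x
  refine ⟨LinearEquiv.ofLinearMap q (colimit.desc G K).hom ?_ ?_⟩
  · have : colimit.desc G K ≫ ModuleCat.ofHom q = 𝟙 _ := by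
      apply colimit.hom_ext
      intro c
      ext v
      change q ((colimit.desc G K).hom (colimit.ι G c v)) = colimit.ι G c v
      rw [hK, hj c ⟨τ c, hτ c⟩ (α c), hq, hp, hw]
    exact congrArg (fun k => k.hom) this
  · apply Submodule.linearMap_qext
    apply DirectSum.linearMap_ext
    intro t
    ext v
    change (colimit.desc G K).hom (q (S.mkQ (DirectSum.lof R T _ t v))) = S.mkQ (DirectSum.lof R T _ t v)
    rw [hq, hp, hK, hj t.1 t (𝟙 _), G.map_id]
    rfl
end

section
/- Let T be a terminal set for D. Let π : ⨁_{t ∈ T} G(t) → colim G be the R-linear map whose restriction to the summand G(t) is the colimit cocone map at t, and let Φ be the R-linear map into ⨁_{t ∈ T} G(t) from the direct sum, indexed by all spans σ = (c, t, t', a : c ⟶ t, a' : c ⟶ t') with t, t' ∈ T, of copies of G(c), sending v ∈ G(c) in the σ-summand to ι_t(G(a)(v)) − ι_{t'}(G(a')(v)). Then the sequence ⨁_σ G(c) →Φ ⨁_{t ∈ T} G(t) →π colim G → 0 is exact: π is surjective and the kernel of π equals the range of Φ. -/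
/-!
STATEMENT 1.  `R` a commutative ring, `D` a small category, `G : D ⥤ ModuleCat R`,
and `T` a terminal set for `D`.  Let `π : ⨁ t : T, G t → colim G` be the `R`-linear map
whose restriction to the summand `G t` is the colimit cocone map at `t`, and let `Φ` be
the `R`-linear map into `⨁ t : T, G t` from the direct sum, indexed by all spans
`σ = (c, t, t', a : c ⟶ t, a' : c ⟶ t')` with `t, t' ∈ T`, of copies of `G c`, sending
`v ∈ G c` in the `σ`-summand to `ι_t (G a v) - ι_{t'} (G a' v)`.  Then
`⨁_σ G c ⟶Φ ⨁_{t ∈ T} G t ⟶π colim G ⟶ 0` is exact: `π` is surjective and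
`ker π = range Φ`.
-/

open CategoryTheory CategoryTheory.Limits DirectSum

attribute [local instance] Classical.propDecidable

universe u

theorem statement1 {R : Type u} [CommRing R] {D : Type u} [SmallCategory D]
    (G : D ⥤ ModuleCat.{u} R) (T : Set D) (hT : IsTerminalSet T)
    -- `π` is the map whose restriction to the summand `G t` is the colimit cocone map at `t`:
    (π : (⨁ t : T, ↥(G.obj t.1)) →ₗ[R] ↥(colimit G))
    (hπ : ∀ (t : T) (v : G.obj t.1),
      π (DirectSum.lof R T (fun s : T => ↥(G.obj s.1)) t v) = colimit.ι G t.1 v)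
    -- `Φ` is the map from the direct sum indexed by all spans `σ` of copies of `G c`,
    -- sending `v` in the `σ`-summand to `ι_t (G a v) - ι_{t'} (G a' v)`:
    (Φ : (⨁ σ : (Σ (c : D) (t : T) (_t' : T), (c ⟶ t.1) × (c ⟶ _t'.1)), ↥(G.obj σ.1))
        →ₗ[R] (⨁ t : T, ↥(G.obj t.1)))
    (hΦ : ∀ (σ : Σ (c : D) (t : T) (_t' : T), (c ⟶ t.1) × (c ⟶ _t'.1)) (v : G.obj σ.1),
      Φ (DirectSum.lof R _ (fun τ : (Σ (c : D) (t : T) (_t' : T), (c ⟶ t.1) × (c ⟶ _t'.1)) =>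
            ↥(G.obj τ.1)) σ v)
        = DirectSum.lof R T (fun s : T => ↥(G.obj s.1)) σ.2.1 (G.map σ.2.2.2.1 v)
          - DirectSum.lof R T (fun s : T => ↥(G.obj s.1)) σ.2.2.1 (G.map σ.2.2.2.2 v)) :
    Function.Surjective π ∧ LinearMap.ker π = LinearMap.range Φ := by
  have hπΦ : ∀ x, π (Φ x) = 0 := by
    intro x
    have h : π ∘ₗ Φ = 0 := by
      apply DirectSum.linearMap_ext
      intro σ
      ext v
      simp only [LinearMap.comp_apply, LinearMap.zero_apply]
      rw [hΦ, map_sub, hπ, hπ, colimit.w_apply, colimit.w_apply, sub_self]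
    exact LinearMap.congr_fun h x
  have key : ∀ (c : D) (t t' : T) (a : c ⟶ t.1) (a' : c ⟶ t'.1) (v : G.obj c),
      (LinearMap.range Φ).mkQ (DirectSum.lof R T (fun s : T => ↥(G.obj s.1)) t (G.map a v))
      = (LinearMap.range Φ).mkQ
        (DirectSum.lof R T (fun s : T => ↥(G.obj s.1)) t' (G.map a' v)) := by
    intro c t t' a a' v
    rw [← sub_eq_zero, ← map_sub, Submodule.mkQ_apply, Submodule.Quotient.mk_eq_zero]
    exact ⟨_, hΦ ⟨c, t, t', a, a'⟩ v⟩
  choose t ht a using hT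
  have a := fun c => (a c).some
  let s : Cocone G :=
    { pt := ModuleCat.of R ((⨁ t : T, ↥(G.obj t.1)) ⧸ LinearMap.range Φ)
      ι :=
        { app := fun c => ModuleCat.ofHom ((LinearMap.range Φ).mkQ ∘ₗ
            (DirectSum.lof R T (fun s : T => ↥(G.obj s.1)) ⟨t c, ht c⟩) ∘ₗ (G.map (a c)).hom)
          naturality := by
            intro c c' f
            ext v
            have := key c ⟨t c', ht c'⟩ ⟨t c, ht c⟩ (f ≫ a c') (a c) v
            rw [G.map_comp] at this
            exact this } }
  refine ⟨?_, le_antisymm ?_ ?_⟩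
  · rw [← LinearMap.range_eq_top, ← Submodule.ker_mkQ (LinearMap.range π), LinearMap.ker_eq_top]
    have h : ModuleCat.ofHom (LinearMap.range π).mkQ
        = (0 : colimit G ⟶ ModuleCat.of R (↥(colimit G) ⧸ LinearMap.range π)) := by
      apply colimit.hom_ext
      intro c
      ext v
      change (LinearMap.range π).mkQ (colimit.ι G c v) = 0
      rw [Submodule.mkQ_apply, Submodule.Quotient.mk_eq_zero]
      refine ⟨DirectSum.lof R T (fun s : T => ↥(G.obj s.1)) ⟨t c, ht c⟩ (G.map (a c) v), ?_⟩
      rw [hπ, colimit.w_apply]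
    exact congrArg ModuleCat.Hom.hom h
  · intro x hx
    have h : (colimit.desc G s).hom ∘ₗ π = (LinearMap.range Φ).mkQ := by
      apply DirectSum.linearMap_ext
      intro u
      ext v
      simp only [LinearMap.comp_apply]
      rw [hπ]
      have h1 : (colimit.desc G s).hom (colimit.ι G u.1 v) = s.ι.app u.1 v :=
        congrArg (fun f => f.hom v) (colimit.ι_desc s u.1)
      rw [h1]
      have := key u.1 ⟨t u.1, ht u.1⟩ u (a u.1) (𝟙 _) v
      rw [G.map_id] at this
      exact this
    have h2 := LinearMap.congr_fun h x
    rw [LinearMap.comp_apply, LinearMap.mem_ker.1 hx, map_zero] at h2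
    exact (Submodule.Quotient.mk_eq_zero _).1 h2.symm
  · rintro _ ⟨x, rfl⟩
    exact hπΦ x
end

section
/- Let d : A →ₗ[R] B admit a retraction σ : B →ₗ[R] A, i.e. σ ∘ d = id_A, and let f : A →ₗ[R] A and h : A →ₗ[R] C be linear maps. Let P ⊆ B × C be the range of the linear map A → B × C, u ↦ (d(f(u)), −h(f(u))). Then the R-linear map B × C → (B ⧸ range(d ∘ f)) × C given by (x, y) ↦ ([x], y + h(σ(x))) is surjective and its kernel is exactly P; consequently the pushout quotient (B × C) ⧸ P is isomorphic as an R-module to (B ⧸ range(d ∘ f)) × C. -/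
/-!
STATEMENT 8.  `R` a commutative ring, `A, B, C` `R`-modules, `d : A →ₗ[R] B` with a
retraction `σ : B →ₗ[R] A` (`σ ∘ d = id`), `f : A →ₗ[R] A`, `h : A →ₗ[R] C`, and
`P ⊆ B × C` the range of `u ↦ (d (f u), -h (f u))`.  Then the map
`B × C → (B ⧸ range (d ∘ f)) × C`, `(x, y) ↦ ([x], y + h (σ x))`, is surjective with
kernel exactly `P`; consequently `(B × C) ⧸ P ≅ (B ⧸ range (d ∘ f)) × C`.
-/

theorem statement8 {R A B C : Type*} [CommRing R]
    [AddCommGroup A] [AddCommGroup B] [AddCommGroup C]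
    [Module R A] [Module R B] [Module R C]
    (d : A →ₗ[R] B) (σ : B →ₗ[R] A) (hσ : σ ∘ₗ d = LinearMap.id)
    (f : A →ₗ[R] A) (h : A →ₗ[R] C) :
    let P : Submodule R (B × C) := LinearMap.range (LinearMap.prod (d ∘ₗ f) (-(h ∘ₗ f)))
    let q : (B × C) →ₗ[R] (B ⧸ LinearMap.range (d ∘ₗ f)) × C :=
      LinearMap.prod ((LinearMap.range (d ∘ₗ f)).mkQ ∘ₗ LinearMap.fst R B C)
        (LinearMap.snd R B C + h ∘ₗ σ ∘ₗ LinearMap.fst R B C)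
    Function.Surjective q ∧ LinearMap.ker q = P ∧
      Nonempty (((B × C) ⧸ P) ≃ₗ[R] (B ⧸ LinearMap.range (d ∘ₗ f)) × C) := by
  intro P q
  have hd : ∀ a, σ (d a) = a := fun a => LinearMap.congr_fun hσ a
  have hsurj : Function.Surjective q := by
    rintro ⟨x, y⟩
    obtain ⟨b, rfl⟩ := Submodule.mkQ_surjective _ x
    refine ⟨(b, y - h (σ b)), ?_⟩
    refine Prod.ext rfl ?_
    change y - h (σ b) + h (σ b) = y
    abel
  have hker : LinearMap.ker q = P := by
    ext ⟨x, y⟩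
    rw [LinearMap.mem_ker]
    constructor
    · intro hq
      have h1 : Submodule.Quotient.mk (p := LinearMap.range (d ∘ₗ f)) x = 0 :=
        congrArg Prod.fst hq
      have h2 : y + h (σ x) = 0 := congrArg Prod.snd hq
      rw [Submodule.Quotient.mk_eq_zero] at h1
      obtain ⟨u, rfl⟩ := h1
      refine ⟨u, Prod.ext rfl ?_⟩
      rw [LinearMap.comp_apply, hd] at h2
      exact (eq_neg_of_add_eq_zero_left h2).symm
    · rintro ⟨u, hu⟩
      have h1 : d (f u) = x := congrArg Prod.fst hu
      have h2 : -h (f u) = y := congrArg Prod.snd hu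
      subst h1 h2
      refine Prod.ext ?_ ?_
      · exact (Submodule.Quotient.mk_eq_zero _).2 ⟨u, rfl⟩
      · change -h (f u) + h (σ (d (f u))) = 0
        rw [hd, neg_add_cancel]
  exact ⟨hsurj, hker, ⟨(Submodule.quotEquivOfEq _ _ hker.symm).trans
    (q.quotKerEquivOfSurjective hsurj)⟩⟩
end

section
/- For every n ≥ 1, m_n ∘ d_n = 𝔨^{n−1} as linear maps V → V; that is, m_n(d_n(x)) = e^{n−1} · x for all x ∈ V, where e = m(Δ(1)) is the handle element. -/
/-!
STATEMENT 11.  `V` is a commutative Frobenius algebra over `R` (a commutative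
`R`-algebra and `R`-coalgebra with cocommutative comultiplication satisfying the
Frobenius condition `Δ(a·b) = (a ⊗ 1)·Δ(b)`).  For every `n ≥ 1`,
`m_n ∘ d_n = 𝔨^{n-1}`, i.e. `m_n (d_n x) = e^{n-1} · x` for all `x ∈ V`, where
`e = m (Δ 1)` is the handle element.

Indexing convention: `TPow R V n = V^[n+1]`, `dIter R V n` is the paper's `d_{n+1}` and
`mIter R V n` the paper's `m_{n+1}`; so `∀ n : ℕ, mIter n (dIter n x) = e^n · x` is
exactly the paper's statement for all `n ≥ 1`.
-/

open TensorProduct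

universe u

variable (R : Type u) [CommRing R] (V : Type u) [CommRing V] [Algebra R V]

/-- `TPow R V n` is the iterated tensor power `V^[n+1]`:  `V^[1] = V` and
`V^[n+1] = V ⊗ V^[n]`. -/
noncomputable def TPow : ℕ → ModuleCat.{u} R
  | 0 => ModuleCat.of R V
  | n + 1 => ModuleCat.of R (V ⊗[R] ↥(TPow n))

/-- The iterated multiplication: `m_1 = id` and `m_{n+1} = m ∘ (id_V ⊗ m_n)`
(`mIter R V n` is the paper's `m_{n+1}`). -/
noncomputable def mIter : ∀ n : ℕ, ↥(TPow R V n) →ₗ[R] V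
  | 0 => LinearMap.id
  | n + 1 => (LinearMap.mul' R V) ∘ₗ (TensorProduct.map LinearMap.id (mIter n))

variable [Coalgebra R V]

/-- The iterated comultiplication: `d_1 = id` and `d_{n+1} = (id_V ⊗ d_n) ∘ Δ`
(`dIter R V n` is the paper's `d_{n+1}`). -/
noncomputable def dIter : ∀ n : ℕ, V →ₗ[R] ↥(TPow R V n)
  | 0 => LinearMap.id
  | n + 1 => (TensorProduct.map LinearMap.id (dIter n)) ∘ₗ Coalgebra.comul

theorem statement11
    -- cocommutativity of the comultiplication
    (hcc : ∀ x : V, (TensorProduct.comm R V V) (Coalgebra.comul x) = Coalgebra.comul x)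
    -- the Frobenius condition: `Δ` is a bimodule map
    (hfr : ∀ a b : V, Coalgebra.comul (a * b) = (a ⊗ₜ[R] (1 : V)) * Coalgebra.comul b)
    (n : ℕ) (x : V) :
    mIter R V n (dIter R V n x)
      = (LinearMap.mul' R V (Coalgebra.comul (1 : V))) ^ n * x := by
  have key : ∀ t : V ⊗[R] V, ∀ a : V,
      LinearMap.mul' R V ((a ⊗ₜ[R] (1 : V)) * t) = a * LinearMap.mul' R V t := by
    intro t a
    induction t with
    | zero => simp
    | add p q hp hq => rw [mul_add, map_add, hp, hq, map_add, mul_add]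
    | tmul p q => simp [mul_assoc]
  induction n generalizing x with
  | zero =>
    rw [pow_zero, one_mul]
    rfl
  | succ n ih =>
    have h : ∀ t : V ⊗[R] V,
        LinearMap.mul' R V (TensorProduct.map LinearMap.id (mIter R V n)
          (TensorProduct.map LinearMap.id (dIter R V n) t))
        = (LinearMap.mul' R V (Coalgebra.comul (1 : V))) ^ n * LinearMap.mul' R V t := by
      intro t
      induction t with
      | zero => simp
      | add p q hp hq => simp only [map_add, hp, hq, mul_add]
      | tmul p q =>
        simp only [TensorProduct.map_tmul, LinearMap.id_apply, LinearMap.mul'_apply, ih]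
        ring
    refine (h (Coalgebra.comul x)).trans ?_
    have hx := hfr x 1
    rw [mul_one] at hx
    rw [hx, key]
    ring
end

section
/- Let 𝔭 := ε ∘ m : V ⊗[R] V → R be the Frobenius pairing. Then the handle operator satisfies 𝔨 = λ ∘ (𝔭 ⊗ id_V) ∘ α ∘ (Δ ⊗ id_V) ∘ Δ, where α is the canonical identification used to regard (V ⊗ V) ⊗ V appropriately and λ : R ⊗[R] V ≅ V is the canonical isomorphism; equivalently, for every x ∈ V, applying Δ, then Δ ⊗ id, then the Frobenius pairing ε ∘ m to the first two tensor factors yields e · x. -/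
/-!
STATEMENT 12.  `V` is a commutative Frobenius algebra over `R`.  Let
`𝔭 := ε ∘ m : V ⊗ V → R` be the Frobenius pairing.  Then the handle operator (i.e.
multiplication by the handle element `e = m (Δ 1)`) satisfies
`𝔨 = λ ∘ (𝔭 ⊗ id_V) ∘ (Δ ⊗ id_V) ∘ Δ`, where `λ : R ⊗ V ≅ V` is the canonical
isomorphism; equivalently, for every `x ∈ V`, applying `Δ`, then `Δ ⊗ id`, then the
Frobenius pairing `ε ∘ m` to the first two tensor factors yields `e · x`.
-/

open TensorProduct

universe u

theorem statement12 (R : Type u) [CommRing R] (V : Type u) [CommRing V] [Algebra R V]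
    [Coalgebra R V]
    -- cocommutativity of the comultiplication
    (hcc : ∀ x : V, (TensorProduct.comm R V V) (Coalgebra.comul x) = Coalgebra.comul x)
    -- the Frobenius condition: `Δ` is a bimodule map
    (hfr : ∀ a b : V, Coalgebra.comul (a * b) = (a ⊗ₜ[R] (1 : V)) * Coalgebra.comul b) :
    LinearMap.mulLeft R (LinearMap.mul' R V (Coalgebra.comul (1 : V)))
      = (TensorProduct.lid R V).toLinearMap
        ∘ₗ TensorProduct.map (Coalgebra.counit ∘ₗ LinearMap.mul' R V) LinearMap.id
        ∘ₗ TensorProduct.map Coalgebra.comul LinearMap.id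
        ∘ₗ Coalgebra.comul := by
  have h1 : ∀ (a : V) (t : V ⊗[R] V),
      LinearMap.mul' R V ((a ⊗ₜ[R] (1 : V)) * t) = a * LinearMap.mul' R V t := by
    intro a t
    induction t with
    | zero => simp
    | tmul x y => simp [mul_assoc]
    | add x y hx hy => rw [mul_add, map_add, hx, hy, map_add, mul_add]
  have h2 : ∀ a : V, LinearMap.mul' R V (Coalgebra.comul (R := R) a)
      = LinearMap.mul' R V (Coalgebra.comul (R := R) (1 : V)) * a := by
    intro a
    have h := hfr a 1
    rw [mul_one] at h
    rw [h, h1, mul_comm]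
  generalize LinearMap.mul' R V (Coalgebra.comul (R := R) (1 : V)) = e at h2 ⊢
  have h3 : ∀ t : V ⊗[R] V,
      TensorProduct.map (Coalgebra.counit (R := R) ∘ₗ LinearMap.mul' R V) (LinearMap.id (M := V))
        (TensorProduct.map Coalgebra.comul LinearMap.id t)
      = LinearMap.rTensor V (Coalgebra.counit (R := R)) ((e ⊗ₜ[R] (1 : V)) * t) := by
    intro t
    induction t with
    | zero => simp
    | tmul x y => simp [h2]
    | add x y hx hy => rw [mul_add, map_add, map_add, map_add, hx, hy]
  ext x
  simp only [LinearMap.comp_apply, LinearMap.mulLeft_apply, LinearEquiv.coe_coe]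
  rw [h3, ← hfr, Coalgebra.rTensor_counit_comul]
  simp
end

section
/- The handle operator commutes with the comultiplication in both tensor factors: Δ ∘ 𝔨 = (id_V ⊗ 𝔨) ∘ Δ = (𝔨 ⊗ id_V) ∘ Δ as linear maps V → V ⊗[R] V; equivalently, Δ(e·x) = (1 ⊗ e)·Δ(x) = (e ⊗ 1)·Δ(x) for all x ∈ V. In particular, every commutative Frobenius algebra, after forgetting the multiplication and keeping 𝔨, is a weak Frobenius algebra. -/
/-!
STATEMENT 13.  `V` is a commutative Frobenius algebra over `R`, with handle element
`e = m (Δ 1)` and handle operator `𝔨 = ` multiplication by `e`.  Then the handle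
operator commutes with the comultiplication in both tensor factors:
`Δ ∘ 𝔨 = (id_V ⊗ 𝔨) ∘ Δ = (𝔨 ⊗ id_V) ∘ Δ`; equivalently
`Δ(e·x) = (1 ⊗ e)·Δ(x) = (e ⊗ 1)·Δ(x)` for all `x`.  (In particular every commutative
Frobenius algebra, after forgetting the multiplication and keeping `𝔨`, is a weak
Frobenius algebra, whose defining compatibility is precisely the first equation.)
-/

open TensorProduct

universe u

theorem statement13 (R : Type u) [CommRing R] (V : Type u) [CommRing V] [Algebra R V]
    [Coalgebra R V]
    -- cocommutativity of the comultiplication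
    (hcc : ∀ x : V, (TensorProduct.comm R V V) (Coalgebra.comul x) = Coalgebra.comul x)
    -- the Frobenius condition: `Δ` is a bimodule map
    (hfr : ∀ a b : V, Coalgebra.comul (a * b) = (a ⊗ₜ[R] (1 : V)) * Coalgebra.comul b) :
    (Coalgebra.comul ∘ₗ LinearMap.mulLeft R (LinearMap.mul' R V (Coalgebra.comul (1 : V)))
      = TensorProduct.map LinearMap.id
          (LinearMap.mulLeft R (LinearMap.mul' R V (Coalgebra.comul (1 : V))))
        ∘ₗ Coalgebra.comul)
    ∧ (Coalgebra.comul ∘ₗ LinearMap.mulLeft R (LinearMap.mul' R V (Coalgebra.comul (1 : V)))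
      = TensorProduct.map
          (LinearMap.mulLeft R (LinearMap.mul' R V (Coalgebra.comul (1 : V))))
          LinearMap.id
        ∘ₗ Coalgebra.comul) := by
  generalize LinearMap.mul' R V (Coalgebra.comul (1 : V)) = e
  have h1 : ∀ t : V ⊗[R] V,
      TensorProduct.map (LinearMap.mulLeft R e) LinearMap.id t = (e ⊗ₜ[R] (1 : V)) * t := by
    intro t
    induction t using TensorProduct.induction_on with
    | zero => simp
    | tmul x y => simp
    | add x y hx hy => rw [map_add, mul_add, hx, hy]
  have h2 : ∀ t : V ⊗[R] V,
      TensorProduct.map LinearMap.id (LinearMap.mulLeft R e) (TensorProduct.comm R V V t)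
        = TensorProduct.comm R V V ((e ⊗ₜ[R] (1 : V)) * t) := by
    intro t
    induction t using TensorProduct.induction_on with
    | zero => simp
    | tmul x y => simp
    | add x y hx hy => rw [map_add, map_add, mul_add, map_add, hx, hy]
  refine ⟨LinearMap.ext fun x => ?_, LinearMap.ext fun x => ?_⟩
  · rw [LinearMap.comp_apply, LinearMap.comp_apply, LinearMap.mulLeft_apply]
    rw [← hcc x, h2, ← hfr, hcc]
  · rw [LinearMap.comp_apply, LinearMap.comp_apply, LinearMap.mulLeft_apply, h1, hfr]
end

section
/- The R-linear endomorphism S := Δ ∘ m of V ⊗[R] V satisfies the Yang–Baxter equation: (S ⊗ id_V) ∘ (id_V ⊗ S) ∘ (S ⊗ id_V) = (id_V ⊗ S) ∘ (S ⊗ id_V) ∘ (id_V ⊗ S) as endomorphisms of the triple tensor product V ⊗[R] V ⊗[R] V (with the tensor factors regrouped by the canonical associativity isomorphisms as needed). -/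
/-!
STATEMENT 14.  `V` is a commutative Frobenius algebra over `R`.  The `R`-linear
endomorphism `S := Δ ∘ m` of `V ⊗ V` satisfies the Yang–Baxter equation
`(S ⊗ id) ∘ (id ⊗ S) ∘ (S ⊗ id) = (id ⊗ S) ∘ (S ⊗ id) ∘ (id ⊗ S)` as endomorphisms of
`V ⊗ V ⊗ V`, where the tensor factors are regrouped by the canonical associativity
isomorphism `α : (V ⊗ V) ⊗ V ≅ V ⊗ (V ⊗ V)` as needed (i.e. `S ⊗ id` is conjugated by
`α` so as to act on `V ⊗ (V ⊗ V)`).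
-/

open TensorProduct

universe u

theorem statement14 (R : Type u) [CommRing R] (V : Type u) [CommRing V] [Algebra R V]
    [Coalgebra R V]
    -- cocommutativity of the comultiplication
    (hcc : ∀ x : V, (TensorProduct.comm R V V) (Coalgebra.comul x) = Coalgebra.comul x)
    -- the Frobenius condition: `Δ` is a bimodule map
    (hfr : ∀ a b : V, Coalgebra.comul (a * b) = (a ⊗ₜ[R] (1 : V)) * Coalgebra.comul b) :
    let S : V ⊗[R] V →ₗ[R] V ⊗[R] V := Coalgebra.comul ∘ₗ LinearMap.mul' R V
    let α := TensorProduct.assoc R V V V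
    let S₁ : V ⊗[R] (V ⊗[R] V) →ₗ[R] V ⊗[R] (V ⊗[R] V) :=
      α.toLinearMap ∘ₗ TensorProduct.map S LinearMap.id ∘ₗ α.symm.toLinearMap
    let S₂ : V ⊗[R] (V ⊗[R] V) →ₗ[R] V ⊗[R] (V ⊗[R] V) := TensorProduct.map LinearMap.id S
    S₁ ∘ₗ S₂ ∘ₗ S₁ = S₂ ∘ₗ S₁ ∘ₗ S₂ := by
  intro S α S₁ S₂
  obtain ⟨n, x, y, he⟩ : ∃ (n : ℕ) (x y : Fin n → V),
      (Coalgebra.comul (1 : V) : V ⊗[R] V) = ∑ i, x i ⊗ₜ[R] y i := by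
    obtain ⟨s, h⟩ := TensorProduct.exists_finset (R := R) (Coalgebra.comul (R := R) (1 : V))
    refine ⟨s.card, fun i => (s.equivFin.symm i).1.1, fun i => (s.equivFin.symm i).1.2, ?_⟩
    rw [h, ← Finset.sum_coe_sort]
    exact (Equiv.sum_comp s.equivFin.symm
      (fun p : s => p.1.1 ⊗ₜ[R] p.1.2)).symm
  have hl : ∀ a : V, (Coalgebra.comul a : V ⊗[R] V) = ∑ i, (a * x i) ⊗ₜ[R] y i := by
    intro a
    have h := hfr a 1
    rw [mul_one, he, Finset.mul_sum] at h
    simpa using h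
  have hr : ∀ a : V, (Coalgebra.comul a : V ⊗[R] V) = ∑ i, x i ⊗ₜ[R] (a * y i) := by
    intro a
    have h1 := hcc 1
    rw [he, map_sum] at h1
    simp only [TensorProduct.comm_tmul] at h1
    have h2 := hfr a 1
    rw [mul_one] at h2
    rw [← hcc a, h2, he, ← h1, Finset.mul_sum, map_sum]
    simp
  have hD : ∀ w u v : V, w = u * v →
      (Coalgebra.comul w : V ⊗[R] V) = ∑ i, (u * x i) ⊗ₜ[R] (v * y i) := by
    rintro _ u v rfl
    rw [hfr, hr, Finset.mul_sum]
    simp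
  have h1 : ∀ p q r u v : V, p * q = u * v →
      S₁ (p ⊗ₜ (q ⊗ₜ r)) = ∑ i, (u * x i) ⊗ₜ[R] ((v * y i) ⊗ₜ[R] r) := by
    intro p q r u v h
    simp [S₁, S, α, hD _ u v h, TensorProduct.sum_tmul]
  have h2 : ∀ p q r u v : V, q * r = u * v →
      S₂ (p ⊗ₜ (q ⊗ₜ r)) = ∑ i, p ⊗ₜ[R] ((u * x i) ⊗ₜ[R] (v * y i)) := by
    intro p q r u v h
    simp [S₂, S, hD _ u v h, TensorProduct.tmul_sum]
  refine TensorProduct.ext_threefold' ?_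
  intro a b c
  have L : S₁ (S₂ (S₁ (a ⊗ₜ (b ⊗ₜ c)))) = ∑ i, ∑ j, ∑ k,
      (a * b * c * x k) ⊗ₜ[R] ((x i * y i * x j * y k) ⊗ₜ[R] y j) := by
    rw [h1 a b c (a * b) 1 (by ring), map_sum, map_sum]
    refine Finset.sum_congr rfl fun i _ => ?_
    rw [h2 _ _ _ (y i * c) 1 (by ring), map_sum]
    refine Finset.sum_congr rfl fun j _ => ?_
    rw [h1 _ _ _ (a * b * c) (x i * y i * x j) (by ring), one_mul]
  have Rr : S₂ (S₁ (S₂ (a ⊗ₜ (b ⊗ₜ c)))) = ∑ i, ∑ k, ∑ j,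
      (a * b * c * x k) ⊗ₜ[R] ((x i * y i * x j * y k) ⊗ₜ[R] y j) := by
    rw [h2 a b c (b * c) 1 (by ring), map_sum, map_sum]
    refine Finset.sum_congr rfl fun i _ => ?_
    rw [h1 _ _ _ (a * b * c) (x i) (by ring), map_sum]
    refine Finset.sum_congr rfl fun k _ => ?_
    rw [h2 _ _ _ (x i * y i * y k) 1 (by ring)]
    refine Finset.sum_congr rfl fun j _ => ?_
    rw [one_mul, mul_right_comm (x i * y i)]
  simp only [LinearMap.comp_apply]
  rw [L, Rr]
  exact Finset.sum_congr rfl fun i _ => Finset.sum_comm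
end
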